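/- arXiv:1111.2828 — 2 statements merged into one kernel-verified Lean document; each statement's English description precedes it below -/
import Mathlib

section
/- Let A ∈ GL(n,ℂ) be generic, and let x, y be the unique upper unitriangular matrices such that x^{−1} A y is counter-diagonal. Then for j > i, the entries of x are given by x_{ij} = |A|_{{i, j+1,…,n},{1,…,n−j+1}} / |A|_{{j,…,n},{1,…,n−j+1}}. -/
/-- The minor `|A|_{I,J}` of a square matrix: the determinant of the submatrix of `A` with
rows indexed by `I` and columns indexed by `J`, both taken in increasing order.
(Junk value `0` if `I` and `J` do not have the same cardinality.) -/
noncomputable def minor {n : ℕ} (A : Matrix (Fin n) (Fin n) ℂ) (I J : Finset (Fin n)) : ℂ :=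
  if h : J.card = I.card then
    (A.submatrix (I.orderEmbOfFin rfl) (J.orderEmbOfFin h)).det
  else 0

/-- A matrix is generic if for every `k ∈ {1, …, n}` (here `k` is 0-based, `k ∈ {0, …, n-1}`)
the minor with rows `{k, …, n-1}` and columns `{0, …, n-1-k}` is nonzero. -/
def IsGeneric {n : ℕ} (A : Matrix (Fin n) (Fin n) ℂ) : Prop :=
  ∀ k : ℕ, k < n →
    minor A (Finset.univ.filter fun i : Fin n => k ≤ (i : ℕ))
      (Finset.univ.filter fun j : Fin n => (j : ℕ) < n - k) ≠ 0

/-- An upper triangular matrix with `1`'s on the diagonal. -/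
def IsUnitriangular {n : ℕ} (x : Matrix (Fin n) (Fin n) ℂ) : Prop :=
  (∀ i, x i i = 1) ∧ ∀ i j : Fin n, j < i → x i j = 0

/-- A matrix `q` is counter-diagonal if `q i j = 0` unless `i + j = n - 1`
(1-based: unless `j = n - i + 1`). -/
def IsCounterDiag {n : ℕ} (q : Matrix (Fin n) (Fin n) ℂ) : Prop :=
  ∀ i j : Fin n, (i : ℕ) + (j : ℕ) ≠ n - 1 → q i j = 0

/-- A matrix `L` is lower counter-triangular if `L i j = 0` whenever `i + j > n - 1`
(1-based: whenever `j > n - i + 1`). -/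
def IsLowerCounterTriangular {n : ℕ} (L : Matrix (Fin n) (Fin n) ℂ) : Prop :=
  ∀ i j : Fin n, n - 1 < (i : ℕ) + (j : ℕ) → L i j = 0

theorem minor_eq_det_submatrix {m n : ℕ} (A : Matrix (Fin n) (Fin n) ℂ) {I J : Finset (Fin n)}
    {f g : Fin m → Fin n} (hf : StrictMono f) (hg : StrictMono g)
    (hI : ∀ r, r ∈ I ↔ ∃ a, f a = r) (hJ : ∀ c, c ∈ J ↔ ∃ a, g a = c) :
    minor A I J = (A.submatrix f g).det := by
  have card_eq : ∀ {K : Finset (Fin n)} {h : Fin m → Fin n}, StrictMono h →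
      (∀ r, r ∈ K ↔ ∃ a, h a = r) → K.card = m := by
    intro K h hh hK
    have : K = Finset.univ.image h := by ext r; simp [hK]
    rw [this, Finset.card_image_of_injective _ hh.injective, Finset.card_fin]
  have hIm := card_eq hf hI
  have hJm := card_eq hg hJ
  subst hIm
  have hf' : f = I.orderEmbOfFin rfl :=
    Finset.orderEmbOfFin_unique rfl (fun a => (hI _).2 ⟨a, rfl⟩) hf
  have hg' : g = J.orderEmbOfFin hJm :=
    Finset.orderEmbOfFin_unique hJm (fun a => (hJ _).2 ⟨a, rfl⟩) hg
  rw [minor, dif_pos hJm, ← hf', ← hg']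

theorem submatrix_mul_of_support {l m n p : Type*} [Fintype m] [Fintype n] {R : Type*}
    [CommRing R] (M N : Matrix n n R) (f : l → n) (g : p → n) {h : m → n}
    (hh : Function.Injective h) (hN : ∀ k, (¬ ∃ a, h a = k) → ∀ c, N k (g c) = 0) :
    (M * N).submatrix f g = M.submatrix f h * N.submatrix h g := by
  classical
  ext a c
  simp only [Matrix.submatrix_apply, Matrix.mul_apply]
  rw [← Finset.sum_image (s := Finset.univ) (g := h) (f := fun k => M (f a) k * N k (g c))
    (fun _ _ _ _ e => hh e)]
  refine (Finset.sum_subset (Finset.subset_univ _) fun k _ hk => ?_).symm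
  rw [hN k (by simpa using hk), mul_zero]

theorem IsUnitriangular.det_submatrix {n m : ℕ} {x : Matrix (Fin n) (Fin n) ℂ}
    (hx : IsUnitriangular x) {h : Fin m → Fin n} (hh : StrictMono h) :
    (x.submatrix h h).det = 1 := by
  rw [Matrix.det_of_isUpperTriangular]
  · simp [hx.1]
  · intro a b hab
    exact hx.2 _ _ (hh hab)

theorem IsUnitriangular.det_eq_one {n : ℕ} {x : Matrix (Fin n) (Fin n) ℂ}
    (hx : IsUnitriangular x) : x.det = 1 := by
  simpa using hx.det_submatrix strictMono_id

/-- The minors with rows `{i, j+1, …}` and the first `n - j` columns are all proportional to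
`x i j`, with a factor independent of `i`. -/
theorem exists_minor_eq_mul {n : ℕ} {A x y : Matrix (Fin n) (Fin n) ℂ}
    (hx : IsUnitriangular x) (hy : IsUnitriangular y)
    (hq : IsCounterDiag (x⁻¹ * A * y)) (j : Fin n) :
    ∃ D : ℂ, ∀ i : Fin n, i ≤ j →
      minor A (Finset.univ.filter fun r : Fin n => r = i ∨ (j : ℕ) + 1 ≤ (r : ℕ))
        (Finset.univ.filter fun c : Fin n => (c : ℕ) < n - (j : ℕ)) = x i j * D := by
  have hj := j.isLt
  let g : Fin (n - j) → Fin n := fun a => ⟨a, by omega⟩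
  let h : Fin (n - j) → Fin n := fun a => ⟨j + a, by omega⟩
  have hg : StrictMono g := fun a b hab => hab
  have hh : StrictMono h := fun a b hab => by
    simp only [h, Fin.lt_def] at hab ⊢
    omega
  set q := x⁻¹ * A * y with hqdef
  have hAy : A * y = x * q := by
    rw [hqdef, Matrix.mul_assoc x⁻¹, Matrix.mul_nonsing_inv_cancel_left]
    rw [hx.det_eq_one]
    exact isUnit_one
  refine ⟨(q.submatrix h g).det, fun i hij => ?_⟩
  let f : Fin (n - j) → Fin n := fun a => if (a : ℕ) = 0 then i else h a
  have hf : StrictMono f := fun a b hab => by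
    simp only [f, h, Fin.lt_def, Fin.le_def] at hab hij ⊢
    split_ifs <;> (try simp only) <;> omega
  have hdet_x : (x.submatrix f h).det = x i j := by
    rw [Matrix.det_of_isUpperTriangular]
    · rw [Finset.prod_eq_single (⟨0, by omega⟩ : Fin (n - j))]
      · simp [f, h]
      · intro a _ ha
        have ha' : (a : ℕ) ≠ 0 := fun e => ha (Fin.ext e)
        simp [f, ha', hx.1]
      · simp
    · intro a b hab
      have hba : b < a := hab
      have ha' : (a : ℕ) ≠ 0 := by
        rw [Fin.lt_def] at hba
        omega
      simp only [Matrix.submatrix_apply, f, if_neg ha']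
      exact hx.2 _ _ (hh hba)
  rw [minor_eq_det_submatrix A hf hg]
  · have hAy_sub : (A * y).submatrix f g = A.submatrix f g * y.submatrix g g := by
      refine submatrix_mul_of_support A y f g hg.injective fun k hk c => hy.2 _ _ ?_
      by_contra hck
      rw [Fin.lt_def] at hck
      exact hk ⟨⟨k, by have := c.isLt; simp only [g] at hck; omega⟩, rfl⟩
    have hxq_sub : (x * q).submatrix f g = x.submatrix f h * q.submatrix h g := by
      refine submatrix_mul_of_support x q f g hh.injective fun k hk c => hq _ _ fun hkc => ?_
      have hc := c.isLt
      simp only [g] at hkc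
      exact hk ⟨⟨k - j, by omega⟩, Fin.ext (by simp only [h]; omega)⟩
    rw [← hdet_x, ← Matrix.det_mul, ← hxq_sub, ← hAy, hAy_sub, Matrix.det_mul,
      hy.det_submatrix hg, mul_one]
  · intro r
    simp only [Finset.mem_filter, Finset.mem_univ, true_and]
    constructor
    · rintro (rfl | hr)
      · exact ⟨⟨0, by omega⟩, by simp [f]⟩
      · refine ⟨⟨r - j, by omega⟩, ?_⟩
        have : (r : ℕ) - j ≠ 0 := by omega
        simp only [f, this, if_false, h]
        exact Fin.ext (by simp only; omega)
    · rintro ⟨a, rfl⟩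
      by_cases ha : (a : ℕ) = 0
      · left
        simp [f, ha]
      · right
        simp only [f, ha, if_false, h]
        omega
  · intro c
    simp only [Finset.mem_filter, Finset.mem_univ, true_and]
    exact ⟨fun hc => ⟨⟨c, hc⟩, rfl⟩, fun ⟨a, ha⟩ => ha ▸ a.isLt⟩

/-- if `A ∈ GL(n, ℂ)` is generic and `x, y` are the (unique) upper unitriangular
matrices with `x⁻¹ A y` counter-diagonal, then for `i < j` (0-based; 1-based `i+1 < j+1`),
`x_{ij} = |A|_{{i, j+1, …, n},{1, …, n−j+1}} / |A|_{{j, …, n},{1, …, n−j+1}}` (1-based sets,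
written here in 0-based form). -/
theorem x_entries {n : ℕ} (A x y : Matrix (Fin n) (Fin n) ℂ)
    (hA : IsGeneric A) (hdet : A.det ≠ 0)
    (hx : IsUnitriangular x) (hy : IsUnitriangular y)
    (hq : IsCounterDiag (x⁻¹ * A * y)) :
    ∀ i j : Fin n, i < j →
      x i j =
        minor A (Finset.univ.filter fun r : Fin n => r = i ∨ (j : ℕ) + 1 ≤ (r : ℕ))
          (Finset.univ.filter fun c : Fin n => (c : ℕ) < n - (j : ℕ)) /
        minor A (Finset.univ.filter fun r : Fin n => j ≤ r)
          (Finset.univ.filter fun c : Fin n => (c : ℕ) < n - (j : ℕ)) := by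
  intro i j hij
  obtain ⟨D, hD⟩ := exists_minor_eq_mul hx hy hq j
  have hrows : (Finset.univ.filter fun r : Fin n => j ≤ r) =
      Finset.univ.filter fun r : Fin n => r = j ∨ (j : ℕ) + 1 ≤ (r : ℕ) := by
    ext r
    simp only [Finset.mem_filter, Finset.mem_univ, true_and, Fin.ext_iff, Fin.le_def]
    omega
  have hden : minor A (Finset.univ.filter fun r : Fin n => j ≤ r)
      (Finset.univ.filter fun c : Fin n => (c : ℕ) < n - (j : ℕ)) = D := by
    rw [hrows, hD j le_rfl, hx.1, one_mul]
  have hD0 : D ≠ 0 := hden ▸ hA j j.isLt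
  rw [hden, hD i hij.le, mul_div_cancel_right₀ _ hD0]
end

section
/- Let n ≥ 2 and let c be an assignment of a nonzero complex number c_t to each non-vertex point t of T^3(n) such that the Ptolemy relations c_{α_{03}}·c_{α_{12}} + c_{α_{01}}·c_{α_{23}} = c_{α_{02}}·c_{α_{13}} hold for all α ∈ T^3(n−2). Then there exist matrices g_0, g_1, g_2, g_3 ∈ SL(n,ℂ) whose Ptolemy coordinates at every non-vertex point t ∈ T^3(n) equal c_t. -/
/-- The list of column vectors obtained by taking, in order, the first `t i` columns of
each matrix `g i`. -/
def ptolemyCols {n m : ℕ} (g : Fin m → Matrix (Fin n) (Fin n) ℂ) (t : Fin m → ℕ) :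
    List (Fin n → ℂ) :=
  (List.finRange m).flatMap fun i =>
    (List.range (t i)).map fun j r => if h : j < n then g i r ⟨j, h⟩ else 0

/-- The Ptolemy coordinate of the tuple `(g 0, …, g (m-1))` at `t = (t 0, …, t (m-1))` with
`∑ i, t i = n`: the determinant of the `n × n` matrix whose columns are, in order, the first
`t 0` columns of `g 0`, the first `t 1` columns of `g 1`, …  (Junk value `0` if `∑ i, t i ≠ n`.) -/
noncomputable def ptolemyCoord {n m : ℕ} (g : Fin m → Matrix (Fin n) (Fin n) ℂ)
    (t : Fin m → ℕ) : ℂ :=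
  if ht : (ptolemyCols g t).length = n then
    (Matrix.of fun r c : Fin n => (ptolemyCols g t).get (Fin.cast ht.symm c) r).det
  else 0

/-- `α + e i + e j`, where `e i` is the `i`-th standard basis vector of `ℤ⁴`. -/
def vtx (α : Fin 4 → ℕ) (i j : Fin 4) : Fin 4 → ℕ :=
  fun m => α m + (if m = i then 1 else 0) + (if m = j then 1 else 0)

/-- The determinant of the matrix whose columns are the members of the list `L`, and `0` if
`L` does not have length `n`. -/
noncomputable def listDet (n : ℕ) (L : List (Fin n → ℂ)) : ℂ :=
  if L.length = n then Matrix.detRowAlternating (fun c : Fin n => L.getD c 0) else 0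

/-- The list of the first `k` members of the sequence `v`. -/
def seqPrefix {V : Type*} (v : ℕ → V) (k : ℕ) : List V := (List.range k).map v

section listDet

variable {n : ℕ}

theorem listDet_swap (P Q : List (Fin n → ℂ)) (x y : Fin n → ℂ) :
    listDet n (P ++ x :: y :: Q) = -listDet n (P ++ y :: x :: Q) := by
  unfold listDet
  by_cases h : (P ++ x :: y :: Q).length = n
  · have h' : (P ++ y :: x :: Q).length = n := by simpa using h
    rw [if_pos h, if_pos h']
    simp only [List.length_append, List.length_cons] at h
    rw [← AlternatingMap.map_swap _ _
      (show (⟨P.length, by omega⟩ : Fin n) ≠ ⟨P.length + 1, by omega⟩ by simp)]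
    congr 1
    funext c
    simp only [Function.comp, Equiv.swap_apply_def, Fin.ext_iff]
    grind
  · have h' : ¬ (P ++ y :: x :: Q).length = n := by simpa using h
    rw [if_neg h, if_neg h', neg_zero]

theorem listDet_move (P B Q : List (Fin n → ℂ)) (x : Fin n → ℂ) :
    listDet n (P ++ x :: (B ++ Q)) = (-1) ^ B.length * listDet n (P ++ B ++ x :: Q) := by
  induction B generalizing P with
  | nil => simp
  | cons b B ih =>
    rw [List.cons_append, listDet_swap]
    have := ih (P ++ [b])
    simp only [List.append_assoc, List.cons_append, List.nil_append] at this ⊢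
    rw [this, List.length_cons, pow_succ]
    ring

theorem listDet_block_swap (P A B Q : List (Fin n → ℂ)) :
    listDet n (P ++ A ++ B ++ Q) =
      (-1) ^ (A.length * B.length) * listDet n (P ++ B ++ A ++ Q) := by
  induction A generalizing P with
  | nil => simp
  | cons a A ih =>
    have h := ih (P ++ [a])
    have h' := listDet_move P B (A ++ Q) a
    simp only [List.append_assoc, List.cons_append, List.nil_append] at h h' ⊢
    rw [h, h', List.length_cons, add_mul, pow_add, one_mul, mul_assoc]

/-- `listDet` as a linear functional of one member of the list. -/
noncomputable def listDetSlot (P Q : List (Fin n → ℂ)) : (Fin n → ℂ) →ₗ[ℂ] ℂ :=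
  if h : P.length < n ∧ (P.length + Q.length + 1 = n) then
    (Matrix.detRowAlternating (R := ℂ) (n := Fin n)).toMultilinearMap.toLinearMap
      (fun c : Fin n => (P ++ 0 :: Q).getD c 0) ⟨P.length, h.1⟩
  else 0

theorem listDetSlot_apply (P Q : List (Fin n → ℂ)) (x : Fin n → ℂ) :
    listDetSlot P Q x = listDet n (P ++ x :: Q) := by
  unfold listDetSlot listDet
  by_cases h : P.length + Q.length + 1 = n
  · rw [dif_pos ⟨by omega, h⟩, if_pos (by simp; omega)]
    simp only [MultilinearMap.toLinearMap_apply, AlternatingMap.coe_multilinearMap]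
    congr 1
    funext c
    simp only [Function.update_apply, Fin.ext_iff]
    grind
  · rw [dif_neg (by tauto), if_neg (by simp; omega), LinearMap.zero_apply]

theorem listDet_eq_zero_of_not_nodup {L : List (Fin n → ℂ)} (hL : ¬ L.Nodup) :
    listDet n L = 0 := by
  unfold listDet
  split_ifs with h
  · rw [List.nodup_iff_injective_get, Function.not_injective_iff] at hL
    obtain ⟨i, j, hij, hne⟩ := hL
    refine AlternatingMap.map_eq_zero_of_eq _ _ (i := Fin.cast h i) (j := Fin.cast h j) ?_ ?_
    · simpa using hij
    · simpa [Fin.ext_iff] using hne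
  · rfl

theorem listDet_smul_eq_sum {L : List (Fin n → ℂ)} (hL : L.length = n) (x : Fin n → ℂ) :
    listDet n L • x = ∑ c : Fin n, listDet n (L.set c x) • L.getD c 0 := by
  have key := Matrix.mulVec_cramer (Matrix.of fun c : Fin n => L.getD c 0).transpose x
  have h1 : listDet n L = (Matrix.of fun c : Fin n => L.getD c 0).transpose.det := by
    rw [listDet, if_pos hL, Matrix.det_transpose]
    rfl
  rw [h1, ← key]
  ext r
  simp only [Matrix.mulVec, dotProduct, Finset.sum_apply, Pi.smul_apply, smul_eq_mul]
  refine Finset.sum_congr rfl fun c _ => ?_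
  rw [mul_comm]
  congr 1
  rw [Matrix.cramer_transpose_apply, listDet, if_pos (by simpa using hL)]
  change Matrix.det _ = Matrix.det _
  congr 1
  ext i j
  simp only [Matrix.updateRow_apply, Fin.ext_iff, Matrix.of_apply]
  by_cases h : i = c
  · subst h; simp [hL]
  · have h' : (c : ℕ) ≠ i := fun e => h (Fin.ext e.symm)
    simp [h'.symm, List.getD_eq_getElem?_getD, List.getElem?_set_ne h']

theorem listDet_plucker (A : List (Fin n → ℂ)) (a b c d : Fin n → ℂ) :
    listDet n (A ++ [a, d]) * listDet n (A ++ [b, c]) +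
      listDet n (A ++ [a, b]) * listDet n (A ++ [c, d]) =
      listDet n (A ++ [a, c]) * listDet n (A ++ [b, d]) := by
  by_cases hA : A.length + 2 = n
  swap
  · simp [listDet, hA]
  obtain ⟨m, rfl⟩ : ∃ m, n = m + 2 := ⟨n - 2, by omega⟩
  replace hA : A.length = m := by omega
  have key := congrArg (listDetSlot A [d])
    (listDet_smul_eq_sum (L := A ++ [a, b]) (by simp [hA]) c)
  simp only [map_sum, map_smul, listDetSlot_apply, smul_eq_mul] at key
  rw [Fin.sum_univ_castSucc, Fin.sum_univ_castSucc, Finset.sum_eq_zero] at key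
  · have hset : (A ++ [a, b]).set m c = A ++ [c, b] := by simp [← hA]
    have hset' : (A ++ [a, b]).set (m + 1) c = A ++ [a, c] := by
      simp [← hA]
    simp only [Fin.val_castSucc, Fin.val_last, hset, hset'] at key
    have h1 : (A ++ [a, b]).getD m 0 = a := by simp [← hA]
    have h2 : (A ++ [a, b]).getD (m + 1) 0 = b := by
      simp [← hA, List.getD_eq_getElem?_getD]
    rw [h1, h2, listDet_swap A [] c b] at key
    linear_combination key
  · intro i _
    rw [listDet_eq_zero_of_not_nodup (L := A ++ [_, d]), mul_zero]
    intro h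
    have hi : (A ++ [a, b]).getD i 0 ∈ A := by
      have hi : (i : ℕ) < A.length := by omega
      simp [List.getD_eq_getElem?_getD, List.getElem?_append_left hi, List.getElem?_eq_getElem hi]
    exact (List.disjoint_of_nodup_append h) hi (by simp)

theorem listDet_plucker_blocks (A₀ A₁ A₂ A₃ : List (Fin n → ℂ)) (a b c d : Fin n → ℂ) :
    listDet n (A₀ ++ [a] ++ A₁ ++ A₂ ++ A₃ ++ [d]) *
        listDet n (A₀ ++ A₁ ++ [b] ++ A₂ ++ [c] ++ A₃) +
      listDet n (A₀ ++ [a] ++ A₁ ++ [b] ++ A₂ ++ A₃) *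
        listDet n (A₀ ++ A₁ ++ A₂ ++ [c] ++ A₃ ++ [d]) =
      listDet n (A₀ ++ [a] ++ A₁ ++ A₂ ++ [c] ++ A₃) *
        listDet n (A₀ ++ A₁ ++ [b] ++ A₂ ++ A₃ ++ [d]) := by
  have h := listDet_plucker (A₀ ++ A₁ ++ A₂ ++ A₃) a b c d
  have had := listDet_move A₀ (A₁ ++ A₂ ++ A₃) [d] a
  have hbc₁ := listDet_move (A₀ ++ A₁ ++ [b] ++ A₂) A₃ [] c
  have hbc₂ := listDet_move (A₀ ++ A₁) (A₂ ++ A₃) [c] b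
  have hab₁ := listDet_move (A₀ ++ [a] ++ A₁) (A₂ ++ A₃) [] b
  have hab₂ := listDet_move A₀ (A₁ ++ A₂ ++ A₃) [b] a
  have hcd := listDet_move (A₀ ++ A₁ ++ A₂) A₃ [d] c
  have hac₁ := listDet_move (A₀ ++ [a] ++ A₁ ++ A₂) A₃ [] c
  have hac₂ := listDet_move A₀ (A₁ ++ A₂ ++ A₃) [c] a
  have hbd := listDet_move (A₀ ++ A₁) (A₂ ++ A₃) [d] b
  simp only [List.append_assoc, List.cons_append, List.nil_append, List.append_nil,
    List.length_append, pow_add] at *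
  rw [had, hbc₁, hbc₂, hab₁, hab₂, hcd, hac₁, hac₂, hbd]
  linear_combination ((-1) ^ A₁.length * (-1) ^ A₂.length * (-1) ^ A₃.length *
    ((-1) ^ A₂.length * (-1) ^ A₃.length * (-1) ^ A₃.length)) * h

end listDet

section seqPrefix

variable {V : Type*}

@[simp] theorem length_seqPrefix (v : ℕ → V) (k : ℕ) : (seqPrefix v k).length = k := by
  simp [seqPrefix]

@[simp] theorem seqPrefix_zero (v : ℕ → V) : seqPrefix v 0 = [] := rfl

theorem seqPrefix_succ (v : ℕ → V) (k : ℕ) : seqPrefix v (k + 1) = seqPrefix v k ++ [v k] := by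
  simp [seqPrefix, List.range_succ]

theorem seqPrefix_congr {v w : ℕ → V} {k : ℕ} (h : ∀ j < k, v j = w j) :
    seqPrefix v k = seqPrefix w k :=
  List.map_congr_left fun j hj => h j (List.mem_range.mp hj)

theorem mem_seqPrefix {v : ℕ → V} {j k : ℕ} (h : j < k) : v j ∈ seqPrefix v k :=
  List.mem_map.mpr ⟨j, List.mem_range.mpr h, rfl⟩

end seqPrefix

theorem exists_forall_apply_eq_of_triangular {K V : Type*} [Field K] [AddCommGroup V] [Module K V]
    (φ : ℕ → V →ₗ[K] K) (w : ℕ → V) (b : ℕ → K) (p : ℕ → Prop) (m : ℕ)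
    (hzero : ∀ i j, j < i → φ i (w j) = 0) (hdiag : ∀ i < m, p i → φ i (w i) ≠ 0) :
    ∃ x, (∀ i < m, p i → φ i x = b i) ∧ ∀ i, m ≤ i → φ i x = 0 := by
  induction m generalizing b with
  | zero => exact ⟨0, by simp, by simp⟩
  | succ m ih =>
    obtain ⟨a, ha⟩ : ∃ a : K, p m → a * φ m (w m) = b m := by
      by_cases hp : p m
      · exact ⟨b m / φ m (w m), fun _ => div_mul_cancel₀ _ (hdiag m (by omega) hp)⟩
      · exact ⟨0, fun h => absurd h hp⟩
    obtain ⟨x, hx, hx'⟩ := ih (fun i => b i - a * φ i (w m))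
      fun i hi => hdiag i (by omega)
    refine ⟨x + a • w m, fun i hi hp => ?_, fun i hi => ?_⟩
    · rw [map_add, map_smul, smul_eq_mul]
      rcases Nat.lt_succ_iff_lt_or_eq.mp hi with hi | rfl
      · rw [hx i hi hp, sub_add_cancel]
      · rw [hx' i le_rfl, zero_add, ha hp]
    · rw [map_add, map_smul, hx' i (by omega), hzero i m (by omega), smul_zero, zero_add]

theorem exists_seq_listDet_eq {n : ℕ} (u w : ℕ → Fin n → ℂ) (p : ℕ → Prop)
    (d : ℕ → ℕ → ℕ → ℂ) (hd : ∀ k s t, k + s + t = n → p t → d k s t ≠ 0)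
    (hbase : ∀ s t, s + t = n → p t → listDet n (seqPrefix u s ++ seqPrefix w t) = d 0 s t) :
    ∃ v : ℕ → Fin n → ℂ, ∀ k s t, k + s + t = n → p t →
      listDet n (seqPrefix v k ++ seqPrefix u s ++ seqPrefix w t) = d k s t := by
  suffices H : ∀ K, ∃ v : ℕ → Fin n → ℂ, ∀ k ≤ K, ∀ s t, k + s + t = n → p t →
      listDet n (seqPrefix v k ++ seqPrefix u s ++ seqPrefix w t) = d k s t by
    obtain ⟨v, hv⟩ := H n
    exact ⟨v, fun k s t h => hv k (by omega) s t h⟩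
  intro K
  induction K with
  | zero =>
    refine ⟨0, fun k hk s t h hp => ?_⟩
    obtain rfl : k = 0 := by omega
    simpa using hbase s t (by omega) hp
  | succ K ih =>
    obtain ⟨v, hv⟩ := ih
    obtain ⟨x, hx, -⟩ := exists_forall_apply_eq_of_triangular
      (fun s => listDetSlot (seqPrefix v K) (seqPrefix u s ++ seqPrefix w (n - (K + 1) - s)))
      u (fun s => d (K + 1) s (n - (K + 1) - s)) (fun s => p (n - (K + 1) - s)) (n - K)
      (fun s j hj => by
        rw [listDetSlot_apply]
        apply listDet_eq_zero_of_not_nodup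
        have := mem_seqPrefix (v := u) hj
        simp [List.nodup_append, this])
      (fun s hs hp => by
        rw [listDetSlot_apply, listDet_move]
        refine mul_ne_zero (pow_ne_zero _ (by norm_num)) ?_
        have := hv K le_rfl (s + 1) (n - (K + 1) - s) (by omega) hp
        simp only [seqPrefix_succ, List.append_assoc, List.cons_append, List.nil_append]
          at this ⊢
        rw [this]
        exact hd _ _ _ (by omega) hp)
    refine ⟨Function.update v K x, fun k hk s t h hp => ?_⟩
    have hpre : ∀ k ≤ K, seqPrefix (Function.update v K x) k = seqPrefix v k := fun k hk =>
      seqPrefix_congr fun j hj => Function.update_of_ne (by omega) _ _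
    rcases Nat.le_succ_iff.mp hk with hk | rfl
    · rw [hpre k hk]
      exact hv k hk s t h hp
    · obtain rfl : t = n - (K + 1) - s := by omega
      have := hx s (by omega) hp
      rw [listDetSlot_apply] at this
      rw [seqPrefix_succ, hpre K le_rfl, Function.update_self, ← this]
      simp

theorem listDet_seqPrefix_eq_det {n : ℕ} (v : ℕ → Fin n → ℂ) :
    listDet n (seqPrefix v n) = (Matrix.of fun r c : Fin n => v c r).det := by
  rw [listDet, if_pos (length_seqPrefix v n), ← Matrix.det_transpose]
  change Matrix.det _ = Matrix.det _
  congr 1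
  ext i j
  simp [seqPrefix, List.getD_eq_getElem?_getD]

theorem ptolemyCoord_eq_listDet {n : ℕ} (v : Fin 4 → ℕ → Fin n → ℂ) (t : Fin 4 → ℕ)
    (ht : ∀ i, t i ≤ n) :
    ptolemyCoord (fun i => Matrix.of fun r c : Fin n => v i c r) t =
      listDet n (seqPrefix (v 0) (t 0) ++ seqPrefix (v 1) (t 1) ++ seqPrefix (v 2) (t 2) ++
        seqPrefix (v 3) (t 3)) := by
  have hcols : ptolemyCols (fun i => Matrix.of fun r c : Fin n => v i c r) t =
      seqPrefix (v 0) (t 0) ++ seqPrefix (v 1) (t 1) ++ seqPrefix (v 2) (t 2) ++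
        seqPrefix (v 3) (t 3) := by
    have h : ∀ i : Fin 4, ((List.range (t i)).map fun j r =>
        if h : j < n then (Matrix.of fun r c : Fin n => v i c r) r ⟨j, h⟩ else 0) =
        seqPrefix (v i) (t i) := fun i =>
      List.map_congr_left fun j hj => by
        have := List.mem_range.mp hj
        have := ht i
        ext r
        rw [dif_pos (by omega)]
        rfl
    simp only [ptolemyCols, h]
    simp [List.finRange_succ]
  rw [← hcols, ptolemyCoord, listDet]
  by_cases h : (ptolemyCols (fun i => Matrix.of fun r c : Fin n => v i c r) t).length = n
  · rw [dif_pos h, if_pos h, ← Matrix.det_transpose]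
    change Matrix.det _ = Matrix.det _
    congr 1
    ext i j
    simp [List.getD_eq_getElem?_getD, h]
  · rw [dif_neg h, if_neg h]

theorem vtx_vec (a b c d : ℕ) :
    vtx ![a, b, c, d] 0 1 = ![a + 1, b + 1, c, d] ∧ vtx ![a, b, c, d] 0 2 = ![a + 1, b, c + 1, d] ∧
    vtx ![a, b, c, d] 0 3 = ![a + 1, b, c, d + 1] ∧ vtx ![a, b, c, d] 1 2 = ![a, b + 1, c + 1, d] ∧
    vtx ![a, b, c, d] 1 3 = ![a, b + 1, c, d + 1] ∧ vtx ![a, b, c, d] 2 3 = ![a, b, c + 1, d + 1] := by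
  refine ⟨?_, ?_, ?_, ?_, ?_, ?_⟩ <;> ext i <;> fin_cases i <;> simp [vtx]

/-- The Ptolemy relations and the values on the two faces `t 0 = 0` and `t 2 = 0` determine all
Ptolemy coordinates. -/
theorem listDet_eq_of_eq_on_faces {n : ℕ} (c : (Fin 4 → ℕ) → ℂ)
    (hc : ∀ t : Fin 4 → ℕ, ∑ i, t i = n → (∀ i, t i < n) → c t ≠ 0)
    (hrel : ∀ α : Fin 4 → ℕ, (∑ i, α i) + 2 = n →
      c (vtx α 0 3) * c (vtx α 1 2) + c (vtx α 0 1) * c (vtx α 2 3) =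
        c (vtx α 0 2) * c (vtx α 1 3))
    (v : Fin 4 → ℕ → Fin n → ℂ) {D : ℕ → ℕ → ℕ → ℕ → ℂ}
    (hD : ∀ t₀ t₁ t₂ t₃, D t₀ t₁ t₂ t₃ = listDet n (seqPrefix (v 0) t₀ ++ seqPrefix (v 1) t₁ ++
      seqPrefix (v 2) t₂ ++ seqPrefix (v 3) t₃))
    (hface₀ : ∀ t₁ t₂ t₃, t₁ + t₂ + t₃ = n → t₁ < n → t₂ < n → t₃ < n →
      D 0 t₁ t₂ t₃ = c ![0, t₁, t₂, t₃])
    (hface₂ : ∀ t₀ t₁ t₃, t₀ + t₁ + t₃ = n → t₀ < n → t₁ < n → t₃ < n →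
      D t₀ t₁ 0 t₃ = c ![t₀, t₁, 0, t₃])
    (t₀ t₁ t₂ t₃ : ℕ) (hsum : t₀ + t₁ + t₂ + t₃ = n)
    (h₀ : t₀ < n) (h₁ : t₁ < n) (h₂ : t₂ < n) (h₃ : t₃ < n) :
    D t₀ t₁ t₂ t₃ = c ![t₀, t₁, t₂, t₃] := by
  induction hN : t₀ + t₂ using Nat.strong_induction_on generalizing t₀ t₁ t₂ t₃ with
  | _ N ih =>
    subst hN
    rcases t₀ with _ | a
    · exact hface₀ _ _ _ (by omega) h₁ h₂ h₃
    rcases t₂ with _ | b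
    · exact hface₂ _ _ _ (by omega) h₀ h₁ h₃
    have hplucker : D (a + 1) t₁ b (t₃ + 1) * D a (t₁ + 1) (b + 1) t₃ +
        D (a + 1) (t₁ + 1) b t₃ * D a t₁ (b + 1) (t₃ + 1) =
        D (a + 1) t₁ (b + 1) t₃ * D a (t₁ + 1) b (t₃ + 1) := by
      simpa only [hD, seqPrefix_succ, List.append_assoc] using
        listDet_plucker_blocks (seqPrefix (v 0) a) (seqPrefix (v 1) t₁) (seqPrefix (v 2) b)
          (seqPrefix (v 3) t₃) (v 0 a) (v 1 t₁) (v 2 b) (v 3 t₃)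
    have hrel' := hrel ![a, t₁, b, t₃] (by simp [Fin.sum_univ_four]; omega)
    obtain ⟨e01, e02, e03, e12, e13, e23⟩ := vtx_vec a t₁ b t₃
    rw [e01, e02, e03, e12, e13, e23] at hrel'
    have hne : c ![a, t₁ + 1, b, t₃ + 1] ≠ 0 := by
      apply hc
      · simp [Fin.sum_univ_four]; omega
      · intro i; fin_cases i <;> simp <;> omega
    rw [ih (a + 1 + b) (by omega) (a + 1) t₁ b (t₃ + 1) (by omega) (by omega) (by omega)
        (by omega) (by omega) rfl,
      ih (a + (b + 1)) (by omega) a (t₁ + 1) (b + 1) t₃ (by omega) (by omega) (by omega)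
        (by omega) (by omega) rfl,
      ih (a + 1 + b) (by omega) (a + 1) (t₁ + 1) b t₃ (by omega) (by omega) (by omega)
        (by omega) (by omega) rfl,
      ih (a + (b + 1)) (by omega) a t₁ (b + 1) (t₃ + 1) (by omega) (by omega) (by omega)
        (by omega) (by omega) rfl,
      ih (a + b) (by omega) a (t₁ + 1) b (t₃ + 1) (by omega) (by omega) (by omega)
        (by omega) (by omega) rfl, hrel'] at hplucker
    exact (mul_right_cancel₀ hne hplucker).symm

/-- for any assignment of nonzero complex numbers `c t` to the non-vertex
points `t` of `T³(n)` satisfying the Ptolemy relations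
`c_{α₀₃} c_{α₁₂} + c_{α₀₁} c_{α₂₃} = c_{α₀₂} c_{α₁₃}` for all `α ∈ T³(n−2)`, there exist
matrices `g₀, g₁, g₂, g₃ ∈ SL(n, ℂ)` whose Ptolemy coordinates at every non-vertex point
equal `c t`. -/
theorem exists_quadruple_with_ptolemy_coords (n : ℕ) (hn : 2 ≤ n) (c : (Fin 4 → ℕ) → ℂ)
    (hc : ∀ t : Fin 4 → ℕ, ∑ i, t i = n → (∀ i, t i < n) → c t ≠ 0)
    (hrel : ∀ α : Fin 4 → ℕ, (∑ i, α i) + 2 = n →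
      c (vtx α 0 3) * c (vtx α 1 2) + c (vtx α 0 1) * c (vtx α 2 3) =
        c (vtx α 0 2) * c (vtx α 1 3)) :
    ∃ g : Fin 4 → Matrix.SpecialLinearGroup (Fin n) ℂ,
      ∀ t : Fin 4 → ℕ, ∑ i, t i = n → (∀ i, t i < n) →
        ptolemyCoord (fun i => (g i : Matrix (Fin n) (Fin n) ℂ)) t = c t := by
  -- `c`, extended by `1` to the vertices
  obtain ⟨c', hc'⟩ : ∃ c' : (Fin 4 → ℕ) → ℂ, ∀ t, c' t = if ∀ i, t i < n then c t else 1 :=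
    ⟨_, fun _ => rfl⟩
  have hvertex : ∀ t i, n ≤ t i → c' t = 1 := fun t i h => by
    rw [hc', if_neg fun h' => (h' i).not_ge h]
  have hne : ∀ t₀ t₁ t₂ t₃, t₀ + t₁ + t₂ + t₃ = n → c' ![t₀, t₁, t₂, t₃] ≠ 0 := by
    intro t₀ t₁ t₂ t₃ h
    rw [hc']
    split_ifs with h'
    · exact hc _ (by simpa [Fin.sum_univ_four] using h) h'
    · exact one_ne_zero
  have hinner : ∀ t₀ t₁ t₂ t₃, t₀ < n → t₁ < n → t₂ < n → t₃ < n →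
      c' ![t₀, t₁, t₂, t₃] = c ![t₀, t₁, t₂, t₃] := by
    intro t₀ t₁ t₂ t₃ h₀ h₁ h₂ h₃
    rw [hc', if_pos]
    intro i
    fin_cases i <;> simpa
  have hsign : ∀ m : ℕ, ((-1 : ℂ) ^ m) ≠ 0 := fun m => pow_ne_zero _ (by norm_num)
  have hsign' : ∀ m : ℕ, (-1 : ℂ) ^ m * (-1) ^ m = 1 := fun m => by
    rw [← mul_pow]; norm_num
  let v₁ : ℕ → Fin n → ℂ := fun j r => if (r : ℕ) = j then 1 else 0
  have hv₁ : listDet n (seqPrefix v₁ n) = 1 := by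
    rw [listDet_seqPrefix_eq_det, ← Matrix.det_one (n := Fin n)]
    congr 1
    ext i j
    simp [v₁, Matrix.one_apply, Fin.ext_iff]
  obtain ⟨v₃, hv₃⟩ := exists_seq_listDet_eq v₁ v₁ (fun t => t = 0)
    (fun k s _ => (-1) ^ (k * s) * c' ![0, s, 0, k])
    (fun k s t h ht => mul_ne_zero (hsign _) (hne _ _ _ _ (by omega)))
    (fun s t h ht => by
      obtain rfl : t = 0 := ht
      obtain rfl : s = n := by omega
      rw [hvertex _ 1 (by simp)]
      simpa using hv₁)
  have hedge : ∀ s t, s + t = n →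
      listDet n (seqPrefix v₁ s ++ seqPrefix v₃ t) = c' ![0, s, 0, t] := by
    intro s t h
    have h1 := listDet_block_swap [] (seqPrefix v₁ s) (seqPrefix v₃ t) []
    have h2 := hv₃ t s 0 (by omega) rfl
    simp only [List.nil_append, List.append_nil, length_seqPrefix, seqPrefix_zero] at h1 h2
    rw [h1, h2, mul_comm t s, ← mul_assoc, hsign', one_mul]
  obtain ⟨v₀, hv₀⟩ := exists_seq_listDet_eq v₁ v₃ (fun _ => True)
    (fun k s t => c' ![k, s, 0, t]) (fun k s t h _ => hne _ _ _ _ (by omega))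
    (fun s t h _ => hedge s t h)
  obtain ⟨v₂, hv₂⟩ := exists_seq_listDet_eq v₁ v₃ (fun _ => True)
    (fun k s t => (-1) ^ (k * s) * c' ![0, s, k, t])
    (fun k s t h _ => mul_ne_zero (hsign _) (hne _ _ _ _ (by omega)))
    (fun s t h _ => by simpa using hedge s t h)
  have hdet : ∀ i, (Matrix.of fun r c : Fin n => ![v₀, v₁, v₂, v₃] i c r).det = 1 := by
    intro i
    rw [← listDet_seqPrefix_eq_det]
    fin_cases i
    · simpa [hvertex ![n, 0, 0, 0] 0 (by simp)] using hv₀ n 0 0 (by omega) trivial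
    · exact hv₁
    · simpa [hvertex ![0, 0, n, 0] 2 (by simp)] using hv₂ n 0 0 (by omega) trivial
    · simpa [hvertex ![0, 0, 0, n] 3 (by simp)] using hv₃ n 0 0 (by omega) rfl
  refine ⟨fun i => ⟨_, hdet i⟩, fun t ht hlt => ?_⟩
  have hvec : t = ![t 0, t 1, t 2, t 3] := by ext i; fin_cases i <;> rfl
  refine (ptolemyCoord_eq_listDet ![v₀, v₁, v₂, v₃] t fun i => (hlt i).le).trans ?_
  rw [Fin.sum_univ_four] at ht
  conv_rhs => rw [hvec]
  refine listDet_eq_of_eq_on_faces c hc hrel ![v₀, v₁, v₂, v₃] (fun _ _ _ _ => rfl) ?_ ?_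
    (t 0) (t 1) (t 2) (t 3) ht (hlt 0) (hlt 1) (hlt 2) (hlt 3)
  · intro t₁ t₂ t₃ h h₁ h₂ h₃
    have e1 := listDet_block_swap [] (seqPrefix v₁ t₁) (seqPrefix v₂ t₂) (seqPrefix v₃ t₃)
    have e2 := hv₂ t₂ t₁ t₃ (by omega) trivial
    simp only [List.nil_append, length_seqPrefix] at e1
    rw [e2, mul_comm t₂ t₁, ← mul_assoc, hsign', one_mul, hinner _ _ _ _ (by omega) h₁ h₂ h₃] at e1
    simpa using e1
  · intro t₀ t₁ t₃ h h₀ h₁ h₃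
    have e := hv₀ t₀ t₁ t₃ h trivial
    rw [hinner _ _ _ _ h₀ h₁ (by omega) h₃] at e
    simpa using e
end
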